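/- arXiv:math-ph/0612027 — 2 statements merged into one kernel-verified Lean document; each statement's English description precedes it below -/
import Mathlib

section
/- There exists a constant C > 0 such that for all integers n ≥ 1 and all integers k with 1 ≤ k ≤ n, setting α = j_{n+1,k} and β = j_{n,k}, every real r with β/α < r < 1 satisfies |J_n(αr)·r^{−n}/J_n(α) − 1| ≤ C · n² · r^{−n} · (1 − r)². -/
open Real MeasureTheory intervalIntegral

/-- The Bessel function of the first kind of (integer) order `n`, defined by its
everywhere-convergent power series. -/
noncomputable def besselJ (n : ℕ) (x : ℝ) : ℝ :=
  ∑' m : ℕ, ((-1 : ℝ) ^ m / (Nat.factorial m * Nat.factorial (m + n))) * (x / 2) ^ (2 * m + n)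

/-- `x` is the `k`-th positive zero of `f` (for `k ≥ 1`): `x` is a positive zero of `f`
and there are exactly `k - 1` positive zeros of `f` below `x`. -/
def IsKthPosZero (f : ℝ → ℝ) (k : ℕ) (x : ℝ) : Prop :=
  0 < x ∧ f x = 0 ∧ {y : ℝ | 0 < y ∧ y < x ∧ f y = 0}.ncard = k - 1
open Set Filter Topology

noncomputable def cA (n m : ℕ) : ℝ := (-1 : ℝ) ^ m / (Nat.factorial m * Nat.factorial (m + n))

noncomputable def fA (n : ℕ) (t : ℝ) : ℝ := ∑' m : ℕ, cA n m * t ^ m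

lemma cA_abs_le (n m : ℕ) : |cA n m| ≤ 1 / (Nat.factorial m : ℝ) := by
  unfold cA
  rw [abs_div, abs_pow, abs_neg, abs_one, one_pow, abs_of_pos (by positivity)]
  have h1 : (1:ℝ) ≤ (Nat.factorial (m+n) : ℝ) := by exact_mod_cast Nat.factorial_pos _
  have h2 : (0:ℝ) < (Nat.factorial m : ℝ) := by positivity
  exact one_div_le_one_div_of_le h2 (le_mul_of_one_le_right h2.le h1)

lemma cA_succ (n m : ℕ) : ((m:ℝ) + 1) * cA n (m + 1) = - cA (n + 1) m := by
  unfold cA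
  rw [Nat.factorial_succ, show m + 1 + n = m + (n + 1) by ring]
  push_cast
  have h2 : (Nat.factorial m : ℝ) ≠ 0 := by positivity
  have h3 : (Nat.factorial (m + (n+1)) : ℝ) ≠ 0 := by positivity
  have h4 : (m : ℝ) + 1 ≠ 0 := by positivity
  field_simp
  ring

lemma cA_rec (n m : ℕ) : cA n m = ((m:ℝ) + n + 1) * cA (n + 1) m := by
  unfold cA
  rw [show m + (n+1) = (m + n) + 1 by ring, Nat.factorial_succ]
  push_cast
  have h2 : (Nat.factorial m : ℝ) ≠ 0 := by positivity
  have h3 : (Nat.factorial (m + n) : ℝ) ≠ 0 := by positivity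
  have h4 : (m : ℝ) + n + 1 ≠ 0 := by positivity
  field_simp

lemma cA_summable_abs (n : ℕ) (t : ℝ) : Summable fun m => |cA n m| * |t| ^ m := by
  refine Summable.of_nonneg_of_le (fun m => by positivity) (fun m => ?_)
    (Real.summable_pow_div_factorial |t|)
  have := mul_le_mul_of_nonneg_right (cA_abs_le n m) (pow_nonneg (abs_nonneg t) m)
  calc _ ≤ _ := this
    _ = _ := by ring

lemma cA_summable (n : ℕ) (t : ℝ) : Summable fun m => cA n m * t ^ m := by
  refine Summable.of_norm ?_
  simpa [abs_mul, abs_pow] using cA_summable_abs n t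

lemma fA_deriv (n : ℕ) (t : ℝ) : HasDerivAt (fA n) (- fA (n + 1) t) t := by
  have hu : Summable fun m : ℕ => |cA n m| * (m * (|t| + 1) ^ (m - 1)) := by
    rw [← summable_nat_add_iff 1]
    refine (cA_summable_abs (n+1) (|t|+1)).congr (fun m => ?_)
    have h := congrArg abs (cA_succ n m)
    rw [abs_neg, abs_mul, abs_of_nonneg (by positivity : (0:ℝ) ≤ (m:ℝ)+1)] at h
    rw [← h, abs_of_nonneg (by positivity : 0 ≤ |t| + 1)]
    simp only [Nat.cast_add, Nat.cast_one, Nat.add_sub_cancel]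
    ring
  have key := hasDerivAt_tsum_of_isPreconnected (g := fun m t => cA n m * t ^ m)
    (g' := fun m t => cA n m * (m * t ^ (m - 1))) (t := Metric.ball 0 (|t| + 1)) (y₀ := t) (y := t)
    hu Metric.isOpen_ball (convex_ball _ _).isPreconnected
    (fun m y _ => (hasDerivAt_pow m y).const_mul _)
    (fun m y hy => by
      have hy' : |y| ≤ |t| + 1 := by
        have := mem_ball_zero_iff.1 hy
        exact this.le
      simp only [norm_mul, norm_pow, Real.norm_eq_abs, Nat.abs_cast]
      gcongr)
    (by simp) (cA_summable n t) (by simp)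
  have hs : Summable fun m : ℕ => cA n m * ((m:ℝ) * t ^ (m - 1)) := by
    refine Summable.of_norm_bounded hu (fun m => ?_)
    simp only [norm_mul, norm_pow, Real.norm_eq_abs, Nat.abs_cast]
    gcongr
    linarith
  suffices e : ∑' m : ℕ, cA n m * ((m:ℝ) * t ^ (m - 1)) = - fA (n + 1) t by
    rw [e] at key
    exact key
  rw [hs.tsum_eq_zero_add]
  simp only [Nat.cast_zero, zero_mul, mul_zero, zero_add, fA]
  rw [← tsum_neg]
  refine tsum_congr (fun m => ?_)
  rw [← neg_mul, ← cA_succ]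
  simp only [Nat.cast_add, Nat.cast_one, Nat.add_sub_cancel]
  ring

lemma fA_rec (n : ℕ) (t : ℝ) : t * fA (n + 2) t - (n + 1) * fA (n + 1) t + fA n t = 0 := by
  have h1 : fA n t - (n+1) * fA (n+1) t = ∑' m : ℕ, (m : ℝ) * cA (n+1) m * t ^ m := by
    unfold fA
    rw [← tsum_mul_left, ← (cA_summable n t).tsum_sub ((cA_summable (n+1) t).mul_left _)]
    refine tsum_congr (fun m => ?_)
    rw [cA_rec n m]
    ring
  have hs : Summable fun m : ℕ => (m : ℝ) * cA (n+1) m * t ^ m := by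
    refine ((cA_summable n t).sub ((cA_summable (n+1) t).mul_left ((n:ℝ)+1))).congr (fun m => ?_)
    rw [cA_rec n m]
    ring
  have h2 : ∑' m : ℕ, (m : ℝ) * cA (n+1) m * t ^ m = - (t * fA (n+2) t) := by
    rw [hs.tsum_eq_zero_add]
    unfold fA
    rw [← tsum_mul_left, ← tsum_neg]
    simp only [Nat.cast_zero, zero_mul, zero_add]
    refine tsum_congr (fun m => ?_)
    push_cast
    rw [cA_succ (n+1) m]
    ring
  linarith

lemma besselJ_eq (n : ℕ) (x : ℝ) : besselJ n x = (x / 2) ^ n * fA n (x ^ 2 / 4) := by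
  unfold besselJ fA
  rw [← tsum_mul_left]
  refine tsum_congr (fun m => ?_)
  have : (x^2/4) = (x/2)^2 := by ring
  rw [this, pow_add, pow_mul]
  unfold cA
  ring

lemma besselJ_zero_iff (n : ℕ) {x : ℝ} (hx : 0 < x) : besselJ n x = 0 ↔ fA n (x ^ 2 / 4) = 0 := by
  rw [besselJ_eq, mul_eq_zero]
  have : (x/2)^n ≠ 0 := by positivity
  simp [this]

lemma fA_analytic (n : ℕ) : AnalyticOnNhd ℝ (fA n) univ := by
  have hr : (FormalMultilinearSeries.ofScalars ℝ (cA n)).radius = ⊤ := by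
    apply FormalMultilinearSeries.radius_eq_top_of_summable_norm
    intro r
    refine (cA_summable_abs n r).congr (fun m => ?_)
    rw [FormalMultilinearSeries.ofScalars_norm]
    simp
  have h := FormalMultilinearSeries.hasFPowerSeriesOnBall
    (FormalMultilinearSeries.ofScalars ℝ (cA n)) (by rw [hr]; simp)
  rw [hr] at h
  have e : (FormalMultilinearSeries.ofScalars ℝ (cA n)).sum = fA n := by
    have := FormalMultilinearSeries.ofScalarsSum_eq_tsum (E := ℝ) (cA n)
    unfold FormalMultilinearSeries.ofScalarsSum at this
    rw [this]
    funext t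
    simp [fA]
  rw [e] at h
  have := h.analyticOnNhd
  simpa using this

lemma fA_zero (n : ℕ) : fA n 0 ≠ 0 := by
  unfold fA
  rw [tsum_eq_single 0 (fun m hm => by simp [hm])]
  simp [cA]
  positivity

lemma bessel_zeros_finite (n : ℕ) (x : ℝ) : {y : ℝ | 0 < y ∧ y < x ∧ besselJ n y = 0}.Finite := by
  by_contra hinf
  have hsub : {y : ℝ | 0 < y ∧ y < x ∧ besselJ n y = 0} ⊆ Icc 0 x := fun y hy => ⟨hy.1.le, hy.2.1.le⟩
  obtain ⟨z, -, hz⟩ := Set.Infinite.exists_accPt_of_subset_isCompact hinf isCompact_Icc hsub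
  have hA : AnalyticOnNhd ℝ (fun y : ℝ => fA n (y ^ 2 / 4)) univ := by
    intro y _
    have h1 : AnalyticAt ℝ (fun y : ℝ => y ^ 2 / 4) y := by fun_prop
    exact AnalyticAt.fun_comp (f := fun y : ℝ => y ^ 2 / 4) (fA_analytic n (y^2/4) (mem_univ _)) h1
  have hfreq : ∃ᶠ y in 𝓝[≠] z, fA n (y ^ 2 / 4) = 0 := by
    rw [accPt_iff_frequently_nhdsNE] at hz
    exact hz.mono (fun y hy => (besselJ_zero_iff n hy.1).1 hy.2.2)
  have := hA.eqOn_zero_of_preconnected_of_frequently_eq_zero isPreconnected_univ (mem_univ z) hfreq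
  have h0 := this (mem_univ 0)
  simp at h0
  exact fA_zero n h0

lemma pos_or_neg_of_ne {f : ℝ → ℝ} {S : Set ℝ} (hS : IsPreconnected S) (hf : ContinuousOn f S)
    (h : ∀ x ∈ S, f x ≠ 0) : (∀ x ∈ S, 0 < f x) ∨ (∀ x ∈ S, f x < 0) := by
  by_contra hc
  push Not at hc
  obtain ⟨⟨x, hx, hx0⟩, ⟨y, hy, hy0⟩⟩ := hc
  obtain ⟨z, hz, hz0⟩ := hS.intermediate_value hx hy hf ⟨hx0, hy0⟩
  exact h z hz hz0

lemma sturm_aux (N : ℕ) (hN : 1 ≤ N) (a : ℝ) (ha : 2 * (N:ℝ) ≤ a) (f f1 : ℝ → ℝ)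
    (hf : ∀ x, HasDerivAt f (f1 x) x)
    (hf1 : ∀ x, 0 < x → HasDerivAt f1 (-((2 * N + 1) / x) * f1 x - f x) x)
    (hpos : ∀ x ∈ Ioo a (a + 2 * π), 0 < f x) : False := by
  have hN' : (1:ℝ) ≤ N := by exact_mod_cast hN
  have hπ := Real.pi_pos
  have ha0 : 0 < a := by linarith
  have hfc : Continuous f := continuous_iff_continuousAt.2 fun x => (hf x).continuousAt
  have hcl : ∀ x ∈ Icc a (a + 2 * π), 0 ≤ f x := by
    have hne : a ≠ a + 2 * π := by linarith
    have h1 : IsClosed {x : ℝ | 0 ≤ f x} := isClosed_le continuous_const hfc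
    have h2 : Ioo a (a + 2 * π) ⊆ {x : ℝ | 0 ≤ f x} := fun x hx => (hpos x hx).le
    have h3 := h1.closure_subset_iff.2 h2
    rw [closure_Ioo hne] at h3
    exact h3
  set W : ℝ → ℝ := fun x => x ^ ((N:ℝ) + 1/2) *
    ((((N:ℝ) + 1/2) * f x / x + f1 x) * sin ((x - a) / 2) - f x * (cos ((x - a) / 2) / 2)) with hW
  have hWd : ∀ x, 0 < x → HasDerivAt W
      (x ^ ((N:ℝ) + 1/2) * f x * sin ((x - a) / 2) * (((N:ℝ)^2 - 1/4) / x ^ 2 - 3/4)) x := by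
    intro x hx
    have hp : HasDerivAt (fun x : ℝ => x ^ ((N:ℝ) + 1/2)) (((N:ℝ) + 1/2) / x * x ^ ((N:ℝ) + 1/2)) x := by
      have := Real.hasDerivAt_rpow_const (x := x) (p := (N:ℝ) + 1/2) (Or.inl hx.ne')
      convert this using 1
      rw [Real.rpow_sub_one hx.ne']
      ring
    have hl : HasDerivAt (fun x : ℝ => (x - a) / 2) (1/2) x := ((hasDerivAt_id x).sub_const a).div_const 2
    have hs := hl.sin
    have hc := hl.cos
    have h1 := ((((hf x).const_mul ((N:ℝ)+1/2)).div (hasDerivAt_id x) hx.ne').add (hf1 x hx)).mul hs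
    have h2 := (hf x).mul (hc.div_const 2)
    have h3 := hp.mul (h1.sub h2)
    refine h3.congr_deriv ?_
    simp only [Pi.add_apply, Pi.mul_apply, Pi.sub_apply, Pi.div_apply, id]
    field_simp
    ring
  have hlt : a < a + 2 * π := by linarith
  obtain ⟨c, hc, hceq⟩ := exists_hasDerivAt_eq_slope W _ hlt
    (fun x hx => (hWd x (by linarith [hx.1])).continuousAt.continuousWithinAt)
    (fun x hx => hWd x (by linarith [hx.1]))
  have hc0 : 0 < c := by linarith [hc.1]
  have hWa : W a ≤ 0 := by
    simp only [hW]
    have : 0 ≤ a ^ ((N:ℝ) + 1/2) * f a := mul_nonneg (by positivity) (hcl a ⟨le_rfl, hlt.le⟩)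
    simp
    simp at this
    nlinarith
  have hWb : 0 ≤ W (a + 2 * π) := by
    simp only [hW]
    have : 0 ≤ (a + 2 * π) ^ ((N:ℝ) + 1/2) * f (a + 2 * π) :=
      mul_nonneg (by positivity) (hcl _ ⟨hlt.le, le_rfl⟩)
    rw [show (a + 2 * π - a) / 2 = π by ring]
    rw [Real.sin_pi, Real.cos_pi]
    nlinarith
  have hsin : 0 < sin ((c - a) / 2) := Real.sin_pos_of_pos_of_lt_pi (by linarith [hc.1]) (by linarith [hc.2])
  have hq : ((N:ℝ)^2 - 1/4) / c ^ 2 - 3/4 < 0 := by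
    have : ((N:ℝ)^2 - 1/4) / c ^ 2 < 3/4 := by
      rw [div_lt_iff₀ (by positivity)]
      nlinarith [hc.1]
    linarith
  have hneg : c ^ ((N:ℝ) + 1/2) * f c * sin ((c - a) / 2) * (((N:ℝ)^2 - 1/4) / c ^ 2 - 3/4) < 0 :=
    mul_neg_of_pos_of_neg (mul_pos (mul_pos (Real.rpow_pos_of_pos hc0 _) (hpos c hc)) hsin) hq
  rw [hceq] at hneg
  have : 0 ≤ (W (a + 2 * π) - W a) / (a + 2 * π - a) := div_nonneg (by linarith) (by linarith)
  linarith

lemma phi_deriv (n : ℕ) (x : ℝ) :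
    HasDerivAt (fun x : ℝ => fA n (x ^ 2 / 4)) (-(x / 2) * fA (n + 1) (x ^ 2 / 4)) x := by
  have h1 : HasDerivAt (fun x : ℝ => x ^ 2 / 4) (x / 2) x := by
    refine ((hasDerivAt_pow 2 x).div_const 4).congr_deriv ?_
    simp
    ring
  refine ((fA_deriv n (x ^ 2 / 4)).comp x h1).congr_deriv ?_
  ring

lemma sturm (N : ℕ) (hN : 1 ≤ N) (a : ℝ) (ha : 2 * (N:ℝ) ≤ a) :
    ∃ x ∈ Ioo a (a + 2 * π), fA N (x ^ 2 / 4) = 0 := by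
  by_contra hc
  push Not at hc
  have hd := phi_deriv N
  have hd1 : ∀ x : ℝ, 0 < x → HasDerivAt (fun x : ℝ => -(x / 2) * fA (N + 1) (x ^ 2 / 4))
      (-((2 * N + 1) / x) * (-(x / 2) * fA (N + 1) (x ^ 2 / 4)) - fA N (x ^ 2 / 4)) x := by
    intro x hx
    have h1 : HasDerivAt (fun x : ℝ => -(x / 2)) (-(1/2)) x := ((hasDerivAt_id x).div_const 2).neg
    refine (h1.mul (phi_deriv (N+1) x)).congr_deriv ?_
    have := fA_rec N (x ^ 2 / 4)
    field_simp
    linear_combination (4:ℝ) * this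
  rcases pos_or_neg_of_ne isPreconnected_Ioo
    (fun x _ => (hd x).continuousAt.continuousWithinAt) hc with h | h
  · exact sturm_aux N hN a ha _ _ hd hd1 h
  · refine sturm_aux N hN a ha _ _ (fun x => (hd x).neg)
      (fun x hx => (hd1 x hx).neg.congr_deriv ?_) (fun x hx => neg_pos.2 (h x hx))
    simp only [Pi.neg_apply]
    ring

lemma zero_upper (N k : ℕ) (hN : 1 ≤ N) (hk : 1 ≤ k) (x : ℝ) (hx : IsKthPosZero (besselJ N) k x) :
    x ≤ 2 * N + 2 * π * k := by
  by_contra hlt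
  push Not at hlt
  have hπ := Real.pi_pos
  have hN' : (1:ℝ) ≤ N := by exact_mod_cast hN
  choose z hz hz0 using fun i : ℕ => sturm N hN (2 * N + 2 * π * i) (by
    have : 0 ≤ 2 * π * (i:ℝ) := by positivity
    linarith)
  have hmono : StrictMono z := strictMono_nat_of_lt_succ (fun i => by
    have h1 := (hz i).2
    have h2 := (hz (i+1)).1
    push_cast at h2
    linarith)
  have hsub : ((Finset.range k).image z : Set ℝ) ⊆ {y : ℝ | 0 < y ∧ y < x ∧ besselJ N y = 0} := by
    intro y hy
    simp only [Finset.coe_image, Finset.coe_range, mem_image, mem_Iio] at hy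
    obtain ⟨i, hi, rfl⟩ := hy
    have h0 : 0 ≤ 2 * π * (i:ℝ) := by positivity
    have hp : 0 < z i := by linarith [(hz i).1]
    have hik : (i:ℝ) + 1 ≤ k := by exact_mod_cast hi
    refine ⟨hp, ?_, (besselJ_zero_iff N hp).2 (hz0 i)⟩
    have := (hz i).2
    nlinarith
  have hcard := Set.ncard_le_ncard hsub (bessel_zeros_finite N x)
  rw [hx.2.2, Set.ncard_coe_finset, Finset.card_image_of_injective _ hmono.injective,
    Finset.card_range] at hcard
  omega

lemma no_zero (n k : ℕ) (hk : 1 ≤ k) (a b c : ℝ) (ha : IsKthPosZero (besselJ (n+1)) k a)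
    (hb : IsKthPosZero (besselJ n) k b) (hbc : b < c) (hca : c ≤ a) (hc : besselJ n c = 0) : False := by
  have hfb := bessel_zeros_finite n b
  have hfa := bessel_zeros_finite (n+1) a
  have hcb := hb.2.2
  have hcaa := ha.2.2
  rw [Set.ncard_eq_toFinset_card _ hfb] at hcb
  rw [Set.ncard_eq_toFinset_card _ hfa] at hcaa
  have hb0 := hb.1
  have hS : ∀ x ∈ insert c (insert b hfb.toFinset), 0 < x ∧ x ≤ c ∧ besselJ n x = 0 := by
    intro x hx
    simp only [Finset.mem_insert, Set.Finite.mem_toFinset, mem_setOf_eq] at hx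
    rcases hx with rfl | rfl | hx
    · exact ⟨by linarith, le_rfl, hc⟩
    · exact ⟨hb0, hbc.le, hb.2.1⟩
    · exact ⟨hx.1, by linarith [hx.2.1], hx.2.2⟩
  have hcard : (insert c (insert b hfb.toFinset)).card = k + 1 := by
    rw [Finset.card_insert_of_notMem, Finset.card_insert_of_notMem, hcb]
    · omega
    · simp
    · simp only [Finset.mem_insert, Set.Finite.mem_toFinset, mem_setOf_eq, not_or]
      exact ⟨hbc.ne', fun h => by linarith [h.2.1]⟩
  have := Finset.card_le_of_interleaved (s := insert c (insert b hfb.toFinset)) (t := hfa.toFinset)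
    (fun x hx y hy hxy _ => by
      obtain ⟨hx0, hxc, hxz⟩ := hS x hx
      obtain ⟨hy0, hyc, hyz⟩ := hS y hy
      rw [besselJ_zero_iff n hx0] at hxz
      rw [besselJ_zero_iff n hy0] at hyz
      obtain ⟨z, hz, hz0⟩ := exists_hasDerivAt_eq_zero hxy
        (fun w _ => (phi_deriv n w).continuousAt.continuousWithinAt) (hxz.trans hyz.symm)
        (fun w _ => phi_deriv n w)
      have hzp : 0 < z := by linarith [hz.1]
      refine ⟨z, ?_, hz⟩
      simp only [Set.Finite.mem_toFinset, mem_setOf_eq]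
      refine ⟨hzp, by linarith [hz.2], (besselJ_zero_iff _ hzp).2 ?_⟩
      rcases mul_eq_zero.1 hz0 with h | h
      · linarith
      · exact h)
  rw [hcard, hcaa] at this
  omega

lemma core (n : ℕ) (T t0 : ℝ) (hT : 0 < T) (h0 : 0 ≤ t0) (hz : fA (n+1) T = 0)
    (hne : ∀ t ∈ Ioc t0 1, fA n (T * t) ≠ 0) (t : ℝ) (ht : t ∈ Ioo t0 1) :
    0 ≤ fA n (T * t) / fA n T ∧ fA n (T * t) / fA n T ≤ 1 ∧
    1 - fA n (T * t) / fA n T ≤ T * (1 - t) ^ 2 / t ^ (n + 1) := by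
  have h01 : t0 < 1 := ht.1.trans ht.2
  have hT0 : fA n T ≠ 0 := by simpa using hne 1 ⟨h01, le_rfl⟩
  set G : ℝ → ℝ := fun t => fA n (T * t) / fA n T with hG
  set G1 : ℝ → ℝ := fun t => - T * fA (n+1) (T * t) / fA n T with hG1
  set G2 : ℝ → ℝ := fun t => T ^ 2 * fA (n+2) (T * t) / fA n T with hG2
  have hl : ∀ t, HasDerivAt (fun t => T * t) T t := fun t => by
    simpa using (hasDerivAt_id t).const_mul T
  have hGd : ∀ t, HasDerivAt G (G1 t) t := fun t => by
    refine (((fA_deriv n (T * t)).comp t (hl t)).div_const _).congr_deriv ?_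
    simp only [hG1]
    ring
  have hG1d : ∀ t, HasDerivAt G1 (G2 t) t := fun t => by
    refine ((((fA_deriv (n+1) (T * t)).comp t (hl t)).const_mul (-T)).div_const _).congr_deriv ?_
    simp only [hG2]
    ring
  set P : ℝ → ℝ := fun t => t ^ (n+1) * G1 t with hP
  have hPd : ∀ t, HasDerivAt P (- T * t ^ n * G t) t := fun t => by
    refine ((hasDerivAt_pow (n+1) t).mul (hG1d t)).congr_deriv ?_
    simp only [hG1, hG2, hG]
    have := fA_rec n (T * t)
    field_simp
    simp only [Nat.cast_add, Nat.cast_one, Nat.add_sub_cancel]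
    rw [pow_succ]
    linear_combination t ^ n * this
  have hG1' : G 1 = 1 := by simp [hG, hT0]
  have hP1 : P 1 = 0 := by simp [hP, hG1, hz]
  have hGpos : ∀ s ∈ Ioc t0 1, 0 < G s := by
    rcases pos_or_neg_of_ne (f := G) (S := Ioc t0 1) isPreconnected_Ioc
      (fun x _ => (hGd x).continuousAt.continuousWithinAt)
      (fun x hx => div_ne_zero (hne x hx) hT0) with h | h
    · exact h
    · have := h 1 ⟨h01, le_rfl⟩
      linarith
  have hPm : ∀ s ∈ Ioo t0 1, ∃ c ∈ Ioo s 1, P s = T * c ^ n * G c * (1 - s) := by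
    intro s hs
    obtain ⟨c, hc, he⟩ := exists_hasDerivAt_eq_slope P _ hs.2
      (fun x _ => (hPd x).continuousAt.continuousWithinAt) (fun x _ => hPd x)
    refine ⟨c, hc, ?_⟩
    have : (1 - s) ≠ 0 := by linarith [hs.2]
    rw [hP1, eq_div_iff this] at he
    linarith
  have hGm : ∀ s ∈ Ioo t0 1, ∃ c ∈ Ioo s 1, 1 - G s = G1 c * (1 - s) := by
    intro s hs
    obtain ⟨c, hc, he⟩ := exists_hasDerivAt_eq_slope G _ hs.2
      (fun x _ => (hGd x).continuousAt.continuousWithinAt) (fun x _ => hGd x)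
    refine ⟨c, hc, ?_⟩
    have : (1 - s) ≠ 0 := by linarith [hs.2]
    rw [hG1', eq_div_iff this] at he
    linarith
  have hG1nn : ∀ s ∈ Ioo t0 1, 0 ≤ G1 s := by
    intro s hs
    have hs0 : 0 < s := by linarith [hs.1]
    obtain ⟨c, hc, he⟩ := hPm s hs
    have hc0 : 0 < c := by linarith [hc.1]
    have hg := hGpos c ⟨hs.1.trans hc.1, hc.2.le⟩
    have h1s : 0 < 1 - s := by linarith [hs.2]
    have : 0 ≤ s ^ (n+1) * G1 s := by
      change 0 ≤ P s
      rw [he]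
      positivity
    exact nonneg_of_mul_nonneg_right this (by positivity)
  have hGle : ∀ s ∈ Ioo t0 1, G s ≤ 1 := by
    intro s hs
    obtain ⟨c, hc, he⟩ := hGm s hs
    have := hG1nn c ⟨hs.1.trans hc.1, hc.2⟩
    have h1s : 0 < 1 - s := by linarith [hs.2]
    nlinarith [mul_nonneg this h1s.le]
  refine ⟨(hGpos t ⟨ht.1, ht.2.le⟩).le, hGle t ht, ?_⟩
  obtain ⟨c, hc, he⟩ := hGm t ht
  have ht0' : 0 < t := by linarith [ht.1]
  have hc0 : 0 < c := by linarith [hc.1]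
  have hct : c ∈ Ioo t0 1 := ⟨ht.1.trans hc.1, hc.2⟩
  have hPc : P c ≤ T * (1 - t) := by
    obtain ⟨d, hd, hde⟩ := hPm c hct
    have hd0 : 0 < d := by linarith [hd.1]
    have hdI : d ∈ Ioo t0 1 := ⟨hct.1.trans hd.1, hd.2⟩
    rw [hde]
    have h1 : d ^ n * G d ≤ 1 :=
      mul_le_one₀ (pow_le_one₀ hd0.le hd.2.le) (hGpos d ⟨hdI.1, hdI.2.le⟩).le (hGle d hdI)
    have h2 : 1 - c ≤ 1 - t := by linarith [hc.1]
    have h3 : 0 ≤ 1 - c := by linarith [hc.2]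
    calc T * d ^ n * G d * (1 - c) = T * ((d ^ n * G d) * (1 - c)) := by ring
      _ ≤ T * (1 * (1 - t)) := by gcongr
      _ = _ := by ring
  have hG1c : G1 c ≤ T * (1 - t) / t ^ (n+1) := by
    rw [le_div_iff₀ (by positivity)]
    calc G1 c * t ^ (n+1) ≤ G1 c * c ^ (n+1) := by
          have := hG1nn c hct
          have := hc.1
          gcongr
      _ = P c := by simp only [hP]; ring
      _ ≤ _ := hPc
  have h1t : 0 ≤ 1 - t := by linarith [ht.2]
  change 1 - G t ≤ _
  rw [he]
  calc G1 c * (1 - t) ≤ T * (1 - t) / t ^ (n+1) * (1 - t) := by gcongr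
    _ = _ := by ring

/-- There is a constant `C > 0` such that for all `n ≥ 1` and `1 ≤ k ≤ n`, with
`a = j (n+1) k` and `b = j n k`, every `r` with `b/a < r < 1` satisfies
`|J_n(a r) r^(-n) / J_n(a) - 1| ≤ C n^2 r^(-n) (1 - r)^2`. -/
theorem gn_bound (j : ℕ → ℕ → ℝ)
    (hj : ∀ n k, 1 ≤ k → IsKthPosZero (besselJ n) k (j n k)) :
    ∃ C : ℝ, 0 < C ∧ ∀ (n k : ℕ), 1 ≤ n → 1 ≤ k → k ≤ n → ∀ r : ℝ,
      j n k / j (n + 1) k < r → r < 1 →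
      |besselJ n (j (n + 1) k * r) * r ^ (-(n : ℤ)) / besselJ n (j (n + 1) k) - 1| ≤
        C * (n : ℝ) ^ 2 * r ^ (-(n : ℤ)) * (1 - r) ^ 2 := by
  refine ⟨3000, by norm_num, ?_⟩
  intro n k hn hk hkn r hr hr1
  have hA := hj (n+1) k hk
  have hB := hj n k hk
  set a := j (n+1) k with ha
  set b := j n k with hb
  have ha0 := hA.1
  have hb0 := hB.1
  have hba : 0 < b / a := by positivity
  have hr0 : 0 < r := hba.trans hr
  have hn' : (1:ℝ) ≤ n := by exact_mod_cast hn
  have hau : a ≤ 11 * n := by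
    have h1 := zero_upper (n+1) k (by omega) hk a hA
    have h2 : (k:ℝ) ≤ n := by exact_mod_cast hkn
    have h3 := Real.pi_lt_d2
    have h4 := Real.pi_pos
    push_cast at h1
    have h5 : π * k ≤ 3.15 * n := by gcongr
    linarith
  have hT : 0 < a ^ 2 / 4 := by positivity
  have hquot : besselJ n (a * r) * r ^ (-(n : ℤ)) / besselJ n a
      = fA n (a ^ 2 / 4 * r ^ 2) / fA n (a ^ 2 / 4) := by
    rw [besselJ_eq, besselJ_eq, zpow_neg, zpow_natCast,
      show (a * r) ^ 2 / 4 = a ^ 2 / 4 * r ^ 2 by ring, show a * r / 2 = a / 2 * r by ring, mul_pow]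
    have h1 : (a / 2) ^ n ≠ 0 := by positivity
    have h2 : r ^ n ≠ 0 := by positivity
    rw [show (a / 2) ^ n * r ^ n * fA n (a ^ 2 / 4 * r ^ 2) * (r ^ n)⁻¹ =
      (a / 2) ^ n * fA n (a ^ 2 / 4 * r ^ 2) * (r ^ n * (r ^ n)⁻¹) by ring, mul_inv_cancel₀ h2,
      mul_one, mul_div_mul_left _ _ h1]
  have hcore := core n (a ^ 2 / 4) ((b / a) ^ 2) hT (by positivity)
    ((besselJ_zero_iff _ ha0).1 hA.2.1) (by
      intro t ht h
      have ht0 : 0 < t := lt_of_le_of_lt (by positivity) ht.1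
      have hs0 : 0 < √t := Real.sqrt_pos.2 ht0
      have hs1 : √t ≤ 1 := Real.sqrt_le_one.2 ht.2
      have hs : b / a < √t := Real.lt_sqrt_of_sq_lt ht.1
      rw [div_lt_iff₀ ha0] at hs
      refine no_zero n k hk a b (a * √t) hA hB (by linarith) (by nlinarith) ?_
      rw [besselJ_zero_iff n (by positivity), mul_pow, Real.sq_sqrt ht0.le]
      rw [← h]
      congr 1
      ring) (r ^ 2) ⟨by gcongr, by nlinarith⟩
  obtain ⟨h1, h2, h3⟩ := hcore
  rw [hquot, abs_sub_comm, abs_of_nonneg (by linarith), zpow_neg, zpow_natCast]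
  have hrn : 1 ≤ (r ^ n)⁻¹ := (one_le_inv₀ (by positivity)).2 (pow_le_one₀ hr0.le hr1.le)
  have hd : 0 < 1 - r := by linarith
  have hfin : 3000 * (n:ℝ) ^ 2 * 1 * (1 - r) ^ 2 ≤ 3000 * (n:ℝ) ^ 2 * (r ^ n)⁻¹ * (1 - r) ^ 2 := by
    gcongr
  refine le_trans ?_ hfin
  by_cases hcase : (n:ℝ) * (1 - r) ≤ 1 / 2
  · have hrn2 : 1 / 2 ≤ r ^ n := by
      have := one_add_mul_le_pow (a := r - 1) (by linarith) n
      rw [show 1 + (r - 1) = r by ring] at this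
      linarith
    have hr4 : 1 / 16 ≤ (r ^ 2) ^ (n + 1) := by
      calc (1:ℝ) / 16 = (1 / 2) ^ 4 := by norm_num
        _ ≤ (r ^ n) ^ 4 := by gcongr
        _ = r ^ (n * 4) := by rw [pow_mul]
        _ ≤ r ^ (2 * (n + 1)) := pow_le_pow_of_le_one hr0.le hr1.le (by omega)
        _ = _ := by rw [pow_mul]
    refine h3.trans ?_
    rw [div_le_iff₀ (by positivity)]
    have h5 : (1 - r ^ 2) ^ 2 ≤ 4 * (1 - r) ^ 2 := by
      have : (1 - r ^ 2) ^ 2 = (1 + r) ^ 2 * (1 - r) ^ 2 := by ring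
      rw [this]
      gcongr
      nlinarith
    calc a ^ 2 / 4 * (1 - r ^ 2) ^ 2 ≤ (11 * n) ^ 2 / 4 * (4 * (1 - r) ^ 2) := by gcongr
      _ ≤ 3000 * (n:ℝ) ^ 2 * 1 * (1 - r) ^ 2 * (1 / 16) := by
        have : 0 ≤ (n:ℝ) ^ 2 * (1 - r) ^ 2 := by positivity
        linarith
      _ ≤ _ := by gcongr
  · push Not at hcase
    have : (1/2 : ℝ) ^ 2 ≤ ((n:ℝ) * (1 - r)) ^ 2 := by gcongr
    rw [mul_pow] at this
    linarith
end

section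
/- Fix an integer n ≥ 1 and a real α > 0, and define the complex-valued polar components V^r(r,θ) = i·n·(J_n(αr) − J_n(α)·r^n)/(α²·r)·e^{inθ} and V^θ(r,θ) = (α·(J_{n+1}(αr) − J_{n−1}(αr)) + 2n·J_n(α)·r^{n−1})/(2α²)·e^{inθ} for r > 0 and θ ∈ ℝ. Then the polar divergence vanishes identically: (1/r)·∂_r(r·V^r(r,θ)) + (1/r)·∂_θ V^θ(r,θ) = 0. -/
open Real MeasureTheory intervalIntegral

theorem besselJ_term_bound (n m : ℕ) (x y : ℝ) (h : |x / 2| ≤ y) :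
    ‖((-1 : ℝ) ^ m / (Nat.factorial m * Nat.factorial (m + n))) * (x / 2) ^ (2 * m + n)‖
      ≤ y ^ n * ((y ^ 2) ^ m / (Nat.factorial m : ℝ)) := by
  have hy : 0 ≤ y := le_trans (abs_nonneg _) h
  have h1 : (1 : ℝ) ≤ (Nat.factorial (m + n) : ℝ) := by
    exact_mod_cast Nat.succ_le_of_lt (Nat.factorial_pos (m + n))
  have h0 : (0 : ℝ) < (Nat.factorial m : ℝ) := by exact_mod_cast Nat.factorial_pos m
  have h2 : |x / 2| ^ (2 * m + n) ≤ y ^ (2 * m + n) := by gcongr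
  have h3 : 1 / ((Nat.factorial m : ℝ) * Nat.factorial (m + n)) ≤ 1 / (Nat.factorial m : ℝ) := by
    apply one_div_le_one_div_of_le h0
    nlinarith
  rw [norm_mul, norm_div, norm_pow, norm_pow, norm_neg, norm_one, one_pow, Real.norm_eq_abs,
    Real.norm_eq_abs, abs_of_pos (by positivity :
      (0 : ℝ) < (Nat.factorial m : ℝ) * Nat.factorial (m + n))]
  calc _ ≤ 1 / (Nat.factorial m : ℝ) * y ^ (2 * m + n) := by gcongr
    _ = _ := by rw [pow_add, pow_mul]; ring

theorem besselJ_summable_bound (n : ℕ) (y : ℝ) :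
    Summable (fun m : ℕ => y ^ n * ((y ^ 2) ^ m / (Nat.factorial m : ℝ))) :=
  (Real.summable_pow_div_factorial (y ^ 2)).mul_left _

theorem besselJ_hasSum (n : ℕ) (x : ℝ) :
    HasSum (fun m : ℕ => ((-1 : ℝ) ^ m / (Nat.factorial m * Nat.factorial (m + n))) *
      (x / 2) ^ (2 * m + n)) (besselJ n x) :=
  (Summable.of_norm_bounded (besselJ_summable_bound n |x / 2|)
    (fun m => besselJ_term_bound n m x _ le_rfl)).hasSum

theorem besselJ_deriv_hasSum (k : ℕ) (x : ℝ) :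
    HasSum (fun m : ℕ => ((-1 : ℝ) ^ m / (Nat.factorial m * Nat.factorial (m + (k + 1)))) *
      ((2 * m + k + 1 : ℝ) * (x / 2) ^ (2 * m + k) * (1 / 2)))
      ((besselJ k x - besselJ (k + 2) x) / 2) := by
  have hA := (besselJ_hasSum k x).mul_right (1 / 2)
  have hB : HasSum (fun m : ℕ =>
      ((-1 : ℝ) ^ m / (Nat.factorial m * Nat.factorial (m + (k + 1)))) *
      ((m : ℝ) * (x / 2) ^ (2 * m + k) * (1 / 2))) (besselJ (k + 2) x * (-1 / 2)) := by
    rw [← hasSum_nat_add_iff' 1]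
    have h := (besselJ_hasSum (k + 2) x).mul_right (-1 / 2)
    simp only [Finset.sum_range_one, Nat.cast_zero, zero_mul, mul_zero, sub_zero]
    refine h.congr_fun ?_
    intro m
    have e : m + 1 + (k + 1) = m + (k + 2) := by ring
    have e2 : 2 * (m + 1) + k = 2 * m + (k + 2) := by ring
    have h0 : (Nat.factorial m : ℝ) ≠ 0 := by exact_mod_cast Nat.factorial_ne_zero m
    have h1 : (Nat.factorial (m + (k + 2)) : ℝ) ≠ 0 := by
      exact_mod_cast Nat.factorial_ne_zero _
    have h2 : (m : ℝ) + 1 ≠ 0 := by positivity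
    rw [e, e2, Nat.factorial_succ, pow_succ]
    push_cast
    field_simp
  have hAB := hA.add hB
  have e : besselJ k x * (1 / 2) + besselJ (k + 2) x * (-1 / 2)
      = (besselJ k x - besselJ (k + 2) x) / 2 := by ring
  rw [e] at hAB
  refine hAB.congr_fun ?_
  intro m
  have h0 : (Nat.factorial m : ℝ) ≠ 0 := by exact_mod_cast Nat.factorial_ne_zero m
  have h1 : (Nat.factorial (m + k) : ℝ) ≠ 0 := by exact_mod_cast Nat.factorial_ne_zero _
  have h2 : (m : ℝ) + k + 1 ≠ 0 := by positivity
  rw [← add_assoc m k 1, Nat.factorial_succ]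
  push_cast
  field_simp
  ring

theorem besselJ_hasDerivAt (k : ℕ) (x : ℝ) :
    HasDerivAt (besselJ (k + 1)) ((besselJ k x - besselJ (k + 2) x) / 2) x := by
  rw [← (besselJ_deriv_hasSum k x).tsum_eq]
  have hx : x ∈ Metric.ball (0 : ℝ) (|x| + 1) := by simp
  refine hasDerivAt_tsum_of_isPreconnected (t := Metric.ball (0 : ℝ) (|x| + 1))
    (g' := fun (m : ℕ) (x : ℝ) => ((-1 : ℝ) ^ m / (Nat.factorial m * Nat.factorial (m + (k + 1)))) *
      ((2 * m + k + 1 : ℝ) * (x / 2) ^ (2 * m + k) * (1 / 2)))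
    (besselJ_summable_bound k ((|x| + 1) / 2)) Metric.isOpen_ball
    (convex_ball _ _).isPreconnected ?_ ?_ hx (besselJ_hasSum (k + 1) x).summable hx
  · intro m y _
    have h := (((hasDerivAt_id y).div_const 2).pow (2 * m + (k + 1))).const_mul
      ((-1 : ℝ) ^ m / (Nat.factorial m * Nat.factorial (m + (k + 1))))
    rw [show 2 * m + (k + 1) - 1 = 2 * m + k by omega] at h
    have e : ((2 * m + (k + 1) : ℕ) : ℝ) = 2 * m + k + 1 := by push_cast; ring
    rw [e] at h
    exact h
  · intro m y hy
    have hy' : |y / 2| ≤ (|x| + 1) / 2 := by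
      rw [abs_div, abs_two]
      have : |y| < |x| + 1 := by simpa using hy
      linarith
    refine le_trans ?_ (besselJ_term_bound k m y _ hy')
    have h0 : (Nat.factorial m : ℝ) ≠ 0 := by exact_mod_cast Nat.factorial_ne_zero m
    have h1 : (Nat.factorial (m + k) : ℝ) ≠ 0 := by exact_mod_cast Nat.factorial_ne_zero _
    have h2 : (0 : ℝ) < (m : ℝ) + k + 1 := by positivity
    have e : ((-1 : ℝ) ^ m / (Nat.factorial m * Nat.factorial (m + (k + 1)))) *
        ((2 * m + k + 1 : ℝ) * (y / 2) ^ (2 * m + k) * (1 / 2)) =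
        ((2 * m + k + 1 : ℝ) / (2 * (m + k + 1))) *
        (((-1 : ℝ) ^ m / (Nat.factorial m * Nat.factorial (m + k))) * (y / 2) ^ (2 * m + k)) := by
      rw [← add_assoc m k 1, Nat.factorial_succ]
      push_cast
      field_simp
    rw [e, norm_mul]
    apply mul_le_of_le_one_left (norm_nonneg _)
    rw [Real.norm_eq_abs, abs_of_nonneg (by positivity), div_le_one (by positivity)]
    have : (0 : ℝ) ≤ k := by positivity
    linarith

/-- The Stokes eigenfunction velocity field on the disk is divergence free:
with radial component `Vr` and tangential component `Vθ` as below, the polar divergence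
`(1/r) ∂_r (r Vr) + (1/r) ∂_θ Vθ` vanishes for all `r > 0` and `θ`. -/
theorem stokes_eigenfunction_div_free (n : ℕ) (hn : 1 ≤ n) (α : ℝ) (hα : 0 < α)
    (Vr Vθ : ℝ → ℝ → ℂ)
    (hVr : ∀ r θ, Vr r θ = Complex.I * (n : ℂ) *
      (((besselJ n (α * r) - besselJ n α * r ^ n) / (α ^ 2 * r) : ℝ) : ℂ) *
        Complex.exp (Complex.I * (n : ℂ) * (θ : ℂ)))
    (hVθ : ∀ r θ, Vθ r θ = (((α * (besselJ (n + 1) (α * r) - besselJ (n - 1) (α * r)) +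
        2 * (n : ℝ) * besselJ n α * r ^ (n - 1)) / (2 * α ^ 2) : ℝ) : ℂ) *
        Complex.exp (Complex.I * (n : ℂ) * (θ : ℂ))) :
    ∀ (r θ : ℝ), 0 < r →
      (1 / (r : ℂ)) * deriv (fun s : ℝ => (s : ℂ) * Vr s θ) r +
        (1 / (r : ℂ)) * deriv (fun t : ℝ => Vθ r t) θ = 0 := by
  intro r θ hr
  obtain ⟨k, rfl⟩ : ∃ k, n = k + 1 := ⟨n - 1, by omega⟩
  have hr0 : r ≠ 0 := hr.ne'
  set c : ℂ := Complex.I * ((k + 1 : ℕ) : ℂ) with hc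
  have hJ : HasDerivAt (fun s : ℝ => besselJ (k + 1) (α * s))
      ((besselJ k (α * r) - besselJ (k + 2) (α * r)) / 2 * α) r := by
    have h := (besselJ_hasDerivAt k (α * r)).comp r ((hasDerivAt_id r).const_mul α)
    rw [mul_one] at h
    exact h
  have hreal : HasDerivAt
      (fun s : ℝ => (besselJ (k + 1) (α * s) - besselJ (k + 1) α * s ^ (k + 1)) / α ^ 2)
      (((besselJ k (α * r) - besselJ (k + 2) (α * r)) / 2 * α
        - besselJ (k + 1) α * (((k + 1 : ℕ) : ℝ) * r ^ k)) / α ^ 2) r := by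
    have hp : HasDerivAt (fun s : ℝ => s ^ (k + 1)) (((k + 1 : ℕ) : ℝ) * r ^ k) r := by
      simpa using hasDerivAt_pow (k + 1) r
    exact (hJ.sub (hp.const_mul _)).div_const _
  have h1 : HasDerivAt (fun s : ℝ => (s : ℂ) * Vr s θ)
      (c * ((((besselJ k (α * r) - besselJ (k + 2) (α * r)) / 2 * α
        - besselJ (k + 1) α * (((k + 1 : ℕ) : ℝ) * r ^ k)) / α ^ 2 : ℝ) : ℂ) *
        Complex.exp (c * (θ : ℂ))) r := by
    refine ((hreal.ofReal_comp.const_mul c).mul_const _).congr_of_eventuallyEq ?_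
    filter_upwards [eventually_ne_nhds hr0] with s hs
    have hs' : (s : ℂ) ≠ 0 := by exact_mod_cast hs
    have hα' : (α : ℂ) ≠ 0 := by exact_mod_cast hα.ne'
    rw [hVr]
    push_cast
    field_simp
  have h2 : HasDerivAt (fun t : ℝ => Vθ r t)
      ((((α * (besselJ (k + 1 + 1) (α * r) - besselJ (k + 1 - 1) (α * r)) +
        2 * ((k + 1 : ℕ) : ℝ) * besselJ (k + 1) α * r ^ (k + 1 - 1)) / (2 * α ^ 2) : ℝ) : ℂ) *
        (Complex.exp (c * (θ : ℂ)) * c)) θ := by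
    have hf : (fun t : ℝ => Vθ r t) = fun t : ℝ => _ := funext (hVθ r)
    rw [hf]
    have ht : HasDerivAt (fun t : ℝ => c * (t : ℂ)) c θ := by
      simpa using (hasDerivAt_id θ).ofReal_comp.const_mul c
    exact ht.cexp.const_mul _
  have hα' : (α : ℂ) ≠ 0 := by exact_mod_cast hα.ne'
  have hr' : (r : ℂ) ≠ 0 := by exact_mod_cast hr0
  rw [h1.deriv, h2.deriv, Nat.add_sub_cancel]
  push_cast
  field_simp
  ring
end
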